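/- Let lambda0 : V' -> ZMod d' be a function and phi0 : V' -> V' a ZMod d'-linear map such that the induced ZMod d-linear map psi : V -> V (the unique linear map satisfying psi(vbar) = (phi0 v)bar for all v in V') preserves omega, i.e. psi lies in Sp(V, omega). Then there exist a function lambda : V' -> ZMod d' and a symplectic automorphism phi in Sp(V', omega') such that tau^((lambda0 v).val) * Delta_(phi0 v) = tau^((lambda v).val) * Delta_(phi v) for all v in V'. -/

import Mathlib

noncomputable section

namespace PaperPCl

/-- `d' = 2d` if `d` is even, `d' = d` if `d` is odd. -/
def dp (d : ℕ) : ℕ := if Even d then 2 * d else d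

lemma d_dvd_dp (d : ℕ) : d ∣ dp d := by
  unfold dp; split
  · exact dvd_mul_left d 2
  · rfl

/-- The phase space `V = (ZMod d)^n × (ZMod d)^n`, vectors written `(q, p)`. -/
abbrev V (d n : ℕ) := (Fin n → ZMod d) × (Fin n → ZMod d)

/-- Dot product of two vectors in `(ZMod d)^n`. -/
def dotp {d n : ℕ} (p q : Fin n → ZMod d) : ZMod d := ∑ i, p i * q i

/-- The standard symplectic form `omega((q1,p1),(q2,p2)) = p1·q2 - p2·q1`. -/
def omegaF {d n : ℕ} (v w : V d n) : ZMod d := dotp v.2 w.1 - dotp w.2 v.1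

/-- Componentwise reduction mod `d`, `V' → V`. -/
def reduceV (d n : ℕ) (v : V (dp d) n) : V d n :=
  (fun i => ZMod.castHom (d_dvd_dp d) (ZMod d) (v.1 i),
   fun i => ZMod.castHom (d_dvd_dp d) (ZMod d) (v.2 i))

/-- Componentwise `val`-lift `V → V'`. -/
def liftV (d n : ℕ) (u : V d n) : V (dp d) n :=
  (fun i => ((u.1 i).val : ZMod (dp d)), fun i => ((u.2 i).val : ZMod (dp d)))

/-- `zeta = exp(2 pi i / d)`. -/
def zeta (d : ℕ) : ℂ := Complex.exp (2 * Real.pi * Complex.I / d)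

/-- `tau = exp(pi i / d)` if `d` is even, `tau = zeta^((d+1)/2)` if `d` is odd. -/
def tau (d : ℕ) : ℂ :=
  if Even d then Complex.exp (Real.pi * Complex.I / d) else zeta d ^ ((d + 1) / 2)

/-- The Pauli matrix `D_(q,p) = X^q Z^p`, a `d^n × d^n` complex matrix. -/
def Dop (d n : ℕ) [NeZero d] (u : V d n) : Matrix (Fin n → ZMod d) (Fin n → ZMod d) ℂ :=
  fun r s => if r = s + u.1 then zeta d ^ (dotp u.2 s).val else 0

/-- The displacement operator `Delta_v = tau^(q·p) D_(vbar)` for `v = (q,p) ∈ V'`. -/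
def Delta (d n : ℕ) [NeZero d] (v : V (dp d) n) : Matrix (Fin n → ZMod d) (Fin n → ZMod d) ℂ :=
  tau d ^ (dotp v.1 v.2).val • Dop d n (reduceV d n v)

/-- The large Pauli group `P'`: the subgroup of invertible `d^n × d^n` complex matrices
generated by the scalar matrix `tau • 1` together with all `D_u`, `u ∈ V`. -/
def Pgrp (d n : ℕ) [NeZero d] : Subgroup (Matrix (Fin n → ZMod d) (Fin n → ZMod d) ℂ)ˣ :=
  Subgroup.closure {x | (x : Matrix (Fin n → ZMod d) (Fin n → ZMod d) ℂ)
      = tau d • (1 : Matrix (Fin n → ZMod d) (Fin n → ZMod d) ℂ)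
    ∨ ∃ u : V d n, (x : Matrix (Fin n → ZMod d) (Fin n → ZMod d) ℂ) = Dop d n u}

/-- The underlying matrix of an element of `P'`. -/
def matVal {d n : ℕ} [NeZero d] (g : ↥(Pgrp d n)) : Matrix (Fin n → ZMod d) (Fin n → ZMod d) ℂ :=
  ((g : (Matrix (Fin n → ZMod d) (Fin n → ZMod d) ℂ)ˣ) : Matrix (Fin n → ZMod d) (Fin n → ZMod d) ℂ)

/-- A function `γ : P' → P'` is center-respecting if `γ(z*g) = z*γ(g)`
for every `z` in the center of `P'`. -/
def CenterResp {d n : ℕ} [NeZero d] (γ : ↥(Pgrp d n) → ↥(Pgrp d n)) : Prop :=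
  ∀ z ∈ Subgroup.center ↥(Pgrp d n), ∀ g, γ (z * g) = z * γ g

/-- A group automorphism of `P'` is projective Clifford if it fixes the center pointwise. -/
def IsPCl {d n : ℕ} [NeZero d] (γ : ↥(Pgrp d n) ≃* ↥(Pgrp d n)) : Prop :=
  ∀ z ∈ Subgroup.center ↥(Pgrp d n), γ z = z

/-- A linear automorphism is symplectic if it preserves the standard symplectic form. -/
def IsSymp (d n : ℕ) (ψ : V d n ≃ₗ[ZMod d] V d n) : Prop :=
  ∀ u v : V d n, omegaF (ψ u) (ψ v) = omegaF u v

/-- `b` is a standard basis vector of `V`. -/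
def IsStdBasis {d n : ℕ} (b : V d n) : Prop :=
  (∃ i : Fin n, b = (Pi.single i 1, 0)) ∨ (∃ i : Fin n, b = (0, Pi.single i 1))

/-- `omegaF` as a bilinear form. -/
def omegaBilin (m n : ℕ) : LinearMap.BilinForm (ZMod m) (V m n) :=
  LinearMap.mk₂ (ZMod m) omegaF
    (fun x y z => by
      simp only [omegaF, dotp, Prod.fst_add, Prod.snd_add, Pi.add_apply, add_mul, mul_add,
        Finset.sum_add_distrib]
      ring)
    (fun c x y => by
      simp only [omegaF, dotp, Prod.smul_fst, Prod.smul_snd, Pi.smul_apply, smul_eq_mul,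
        mul_sub, Finset.mul_sum]
      congr 1 <;> exact Finset.sum_congr rfl fun _ _ => by ring)
    (fun x y z => by
      simp only [omegaF, dotp, Prod.fst_add, Prod.snd_add, Pi.add_apply, add_mul, mul_add,
        Finset.sum_add_distrib]
      ring)
    (fun c x y => by
      simp only [omegaF, dotp, Prod.smul_fst, Prod.smul_snd, Pi.smul_apply, smul_eq_mul,
        mul_sub, Finset.mul_sum]
      congr 1 <;> exact Finset.sum_congr rfl fun _ _ => by ring)

lemma omegaBilin_apply {m n : ℕ} (x y : V m n) : omegaBilin m n x y = omegaF x y := rfl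

lemma omegaF_self {m n : ℕ} (x : V m n) : omegaF x x = 0 := sub_self _

lemma omegaF_swap {m n : ℕ} (x y : V m n) : omegaF y x = -omegaF x y := by
  simp [omegaF]

lemma linearMap_apply_eq_sum {m n : ℕ} (f : V m n →ₗ[ZMod m] ZMod m) (x : V m n) :
    f x = ∑ i, x.1 i * f (Pi.single i 1, 0) + ∑ i, x.2 i * f (0, Pi.single i 1) := by
  have hx : x = LinearMap.inl (ZMod m) _ _ x.1 + LinearMap.inr (ZMod m) _ _ x.2 := by simp
  conv_lhs => rw [hx, map_add, ← LinearMap.comp_apply, ← LinearMap.comp_apply,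
    LinearMap.pi_apply_eq_sum_univ (f ∘ₗ LinearMap.inl _ _ _),
    LinearMap.pi_apply_eq_sum_univ (f ∘ₗ LinearMap.inr _ _ _)]
  congr 1 <;> refine Finset.sum_congr rfl fun i _ => ?_ <;> rw [smul_eq_mul, LinearMap.comp_apply] <;>
    · congr 2
      ext j <;> simp [Pi.single_apply, eq_comm]

/-- The vector representing a functional with respect to the symplectic form. -/
lemma exists_omegaF_eq {m n : ℕ} (U : LinearMap.BilinForm (ZMod m) (V m n)) :
    ∃ T : V m n →ₗ[ZMod m] V m n, (∀ x y, omegaF x (T y) = U x y) ∧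
      ∀ y, T y = (fun i => U (0, Pi.single i 1) y, fun i => -U (Pi.single i 1, 0) y) := by
  refine ⟨LinearMap.prod (LinearMap.pi fun i => U (0, Pi.single i 1))
    (LinearMap.pi fun i => -U (Pi.single i 1, 0)), fun x y => ?_, fun y => rfl⟩
  have h := linearMap_apply_eq_sum (LinearMap.flip U y) x
  simp only [LinearMap.flip_apply] at h
  rw [h]
  change ∑ i, x.2 i * U (0, Pi.single i 1) y - ∑ i, -U (Pi.single i 1, 0) y * x.1 i = _
  simp only [neg_mul, Finset.sum_neg_distrib, sub_neg_eq_add, mul_comm (U _ y)]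
  exact add_comm _ _

/-- An alternating form is the antisymmetrization of a bilinear form whose values are
killed by any ring homomorphism killing the values of the alternating form. -/
lemma exists_eq_sub_flip {R S M ι : Type*} [CommRing R] [CommRing S] [AddCommGroup M] [Module R M]
    [Fintype ι] [LinearOrder ι] (b : Module.Basis ι R M) (c : R →+* S)
    (B : LinearMap.BilinForm R M) (hB : B.IsAlt) (hc : ∀ x y, c (B x y) = 0) :
    ∃ U : LinearMap.BilinForm R M, (∀ x y, B x y = U x y - U y x) ∧ ∀ x y, c (U x y) = 0 := by
  let U : LinearMap.BilinForm R M :=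
    Matrix.toBilin b (Matrix.of fun i j => if i < j then B (b i) (b j) else 0)
  have hU : ∀ i j, U (b i) (b j) = if i < j then B (b i) (b j) else 0 := fun i j => by
    rw [← LinearMap.BilinForm.toMatrix_apply b, LinearMap.BilinForm.toMatrix_toBilin]
    rfl
  refine ⟨U, fun x y => ?_, fun x y => ?_⟩
  · have h : B = U - LinearMap.flip U := by
      refine b.ext fun i => b.ext fun j => ?_
      rw [LinearMap.sub_apply, LinearMap.sub_apply, LinearMap.flip_apply, hU, hU]
      rcases lt_trichotomy i j with h | rfl | h
      · simp [h, h.not_gt]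
      · simpa using hB (b i)
      · simp [h, h.not_gt, hB.neg_eq]
    conv_lhs => rw [h]
    simp
  · rw [Matrix.toBilin_apply, map_sum]
    refine Finset.sum_eq_zero fun i _ => ?_
    rw [map_sum]
    refine Finset.sum_eq_zero fun j _ => ?_
    simp only [map_mul, Matrix.of_apply, apply_ite c, hc, map_zero, ite_self, mul_zero, zero_mul]

/-- Reduction mod `d` on scalars. -/
abbrev red (d : ℕ) : ZMod (dp d) →+* ZMod d := ZMod.castHom (d_dvd_dp d) (ZMod d)

lemma red_omegaF {d n : ℕ} (x y : V (dp d) n) :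
    red d (omegaF x y) = omegaF (reduceV d n x) (reduceV d n y) := by
  simp only [omegaF, dotp, reduceV, map_sub, map_sum, map_mul]

lemma reduceV_add {d n : ℕ} (x y : V (dp d) n) :
    reduceV d n (x + y) = reduceV d n x + reduceV d n y := by
  ext i <;> simp only [reduceV, Prod.fst_add, Prod.snd_add, Pi.add_apply, map_add]

lemma dp_dvd_sq (d : ℕ) : dp d ∣ d * d := by
  unfold dp
  split_ifs with h
  · exact Nat.mul_dvd_mul_right h.two_dvd d
  · exact dvd_mul_left d d

instance (d : ℕ) [NeZero d] : NeZero (dp d) :=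
  ⟨by have := NeZero.ne d; unfold dp; split_ifs <;> omega⟩

lemma mul_eq_zero_of_red {d : ℕ} [NeZero d] {a b : ZMod (dp d)}
    (ha : red d a = 0) (hb : red d b = 0) : a * b = 0 := by
  have key : ∀ a : ZMod (dp d), red d a = 0 → d ∣ a.val := fun a h => by
    rw [← ZMod.natCast_eq_zero_iff, ← h, ZMod.castHom_apply, ZMod.natCast_val]
  rw [← ZMod.natCast_zmod_val a, ← ZMod.natCast_zmod_val b, ← Nat.cast_mul,
    ZMod.natCast_eq_zero_iff]
  exact (dp_dvd_sq d).trans (mul_dvd_mul (key a ha) (key b hb))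

lemma IsSymp.injective {m n : ℕ} (f : V m n →ₗ[ZMod m] V m n)
    (hf : ∀ x y, omegaF (f x) (f y) = omegaF x y) : Function.Injective f := by
  rw [injective_iff_map_eq_zero]
  intro x hx
  have h : ∀ y, omegaF x y = 0 := fun y => by
    rw [← hf, hx, ← omegaBilin_apply, map_zero, LinearMap.zero_apply]
  ext i
  · simpa [omegaF, dotp, Pi.single_apply] using h (0, Pi.single i 1)
  · simpa [omegaF, dotp, Pi.single_apply] using h (Pi.single i 1, 0)

/-- A linear map which is symplectic mod `d` is congruent mod `d` to a symplectic one. -/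
lemma exists_symp_lift {d n : ℕ} [NeZero d] (φ0 : V (dp d) n →ₗ[ZMod (dp d)] V (dp d) n)
    (ψ : V d n ≃ₗ[ZMod d] V d n)
    (hcomp : ∀ v : V (dp d) n, ψ (reduceV d n v) = reduceV d n (φ0 v)) (hψ : IsSymp d n ψ) :
    ∃ φ : V (dp d) n ≃ₗ[ZMod (dp d)] V (dp d) n, IsSymp (dp d) n φ ∧
      ∀ v, reduceV d n (φ v) = reduceV d n (φ0 v) := by
  let B : LinearMap.BilinForm (ZMod (dp d)) (V (dp d) n) :=
    (omegaBilin (dp d) n).compl₁₂ φ0 φ0 - omegaBilin (dp d) n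
  have hB : ∀ x y, B x y = omegaF (φ0 x) (φ0 y) - omegaF x y := fun _ _ => rfl
  have hBalt : B.IsAlt := fun x => by rw [hB, omegaF_self, omegaF_self, sub_zero]
  have hBred : ∀ x y, red d (B x y) = 0 := fun x y => by
    rw [hB, map_sub, red_omegaF, red_omegaF, ← hcomp, ← hcomp, hψ, sub_self]
  let b : Module.Basis (Fin (n + n)) (ZMod (dp d)) (V (dp d) n) :=
    ((Pi.basisFun (ZMod (dp d)) (Fin n)).prod (Pi.basisFun (ZMod (dp d)) (Fin n))).reindex
      finSumFinEquiv
  obtain ⟨U, hUB, hUred⟩ := exists_eq_sub_flip b (red d) B hBalt hBred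
  obtain ⟨T, hT, hTval⟩ := exists_omegaF_eq (-U)
  have hTred : ∀ x, reduceV d n (T x) = 0 := fun x => by
    rw [hTval]
    ext i <;> simp only [reduceV, LinearMap.neg_apply, neg_neg, map_neg, hUred, neg_zero] <;> rfl
  have hφ0T : ∀ x, reduceV d n (φ0 (T x)) = 0 := fun x => by rw [← hcomp, hTred, map_zero]
  have hfst : ∀ {x : V (dp d) n}, reduceV d n x = 0 → ∀ i, red d (x.1 i) = 0 :=
    fun h i => congrFun (congrArg Prod.fst h) i
  have hsnd : ∀ {x : V (dp d) n}, reduceV d n x = 0 → ∀ i, red d (x.2 i) = 0 :=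
    fun h i => congrFun (congrArg Prod.snd h) i
  have hBT : ∀ x y, B x (T y) = 0 := fun x y => by
    rw [linearMap_apply_eq_sum (B x) (T y),
      Finset.sum_eq_zero fun i _ => mul_eq_zero_of_red (hfst (hTred y) i) (hBred _ _),
      Finset.sum_eq_zero fun i _ => mul_eq_zero_of_red (hsnd (hTred y) i) (hBred _ _), add_zero]
  have hTT : ∀ x y, omegaF (φ0 (T x)) (φ0 (T y)) = 0 := fun x y => by
    simp only [omegaF, dotp]
    rw [Finset.sum_eq_zero fun i _ => mul_eq_zero_of_red (hsnd (hφ0T x) i) (hfst (hφ0T y) i),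
      Finset.sum_eq_zero fun i _ => mul_eq_zero_of_red (hsnd (hφ0T y) i) (hfst (hφ0T x) i),
      sub_zero]
  have hφ0 : ∀ x y, omegaF (φ0 x) (φ0 (T y)) = -U x y := fun x y => by
    have h := hBT x y
    rw [hB, sub_eq_zero, hT] at h
    exact h
  let f : V (dp d) n →ₗ[ZMod (dp d)] V (dp d) n := φ0 + φ0 ∘ₗ T
  have hf : ∀ x y, omegaF (f x) (f y) = omegaF x y := fun x y => by
    have h : omegaF (f x) (f y) = omegaF (φ0 x) (φ0 y) + omegaF (φ0 x) (φ0 (T y)) +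
        (omegaF (φ0 (T x)) (φ0 y) + omegaF (φ0 (T x)) (φ0 (T y))) := by
      simp only [← omegaBilin_apply, f, LinearMap.add_apply, LinearMap.comp_apply, map_add]
      ring
    have hxy := hUB x y
    rw [hB] at hxy
    rw [h, hTT, hφ0, omegaF_swap (φ0 y) (φ0 (T x)), hφ0]
    linear_combination hxy
  refine ⟨LinearEquiv.ofBijective f (Finite.injective_iff_bijective.1 (IsSymp.injective f hf)),
    hf, fun v => ?_⟩
  change reduceV d n (φ0 v + φ0 (T v)) = _
  rw [reduceV_add, hφ0T, add_zero]

lemma tau_pow_dp (d : ℕ) [NeZero d] : tau d ^ dp d = 1 := by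
  have hd : (d : ℂ) ≠ 0 := NeZero.ne _
  unfold tau dp
  split_ifs
  · rw [← Complex.exp_nat_mul, ← Complex.exp_two_pi_mul_I]
    congr 1
    push_cast
    field_simp
  · rw [← pow_mul, mul_comm, pow_mul, zeta, ← Complex.exp_nat_mul, mul_div_cancel₀ _ hd,
      Complex.exp_two_pi_mul_I, one_pow]

lemma tau_pow_val_add (d : ℕ) [NeZero d] (a b : ZMod (dp d)) :
    tau d ^ (a + b).val = tau d ^ a.val * tau d ^ b.val := by
  rw [ZMod.val_add, ← pow_eq_pow_mod _ (tau_pow_dp d), pow_add]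

theorem symplectic_refinement (d n : ℕ) [NeZero d] (hd : 2 ≤ d) (hn : 1 ≤ n)
    (lam0 : V (dp d) n → ZMod (dp d)) (φ0 : V (dp d) n →ₗ[ZMod (dp d)] V (dp d) n)
    (ψ : V d n ≃ₗ[ZMod d] V d n)
    (hcomp : ∀ v : V (dp d) n, ψ (reduceV d n v) = reduceV d n (φ0 v))
    (hψ : IsSymp d n ψ) :
    ∃ (lam : V (dp d) n → ZMod (dp d)) (φ : V (dp d) n ≃ₗ[ZMod (dp d)] V (dp d) n),
      IsSymp (dp d) n φ ∧
      ∀ v : V (dp d) n,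
        tau d ^ (lam0 v).val • Delta d n (φ0 v) = tau d ^ (lam v).val • Delta d n (φ v) := by
  obtain ⟨φ, hφ, hred⟩ := exists_symp_lift φ0 ψ hcomp hψ
  refine ⟨fun v => lam0 v + dotp (φ0 v).1 (φ0 v).2 - dotp (φ v).1 (φ v).2, φ, hφ, fun v => ?_⟩
  rw [Delta, Delta, smul_smul, smul_smul, hred, ← tau_pow_val_add, ← tau_pow_val_add,
    sub_add_cancel]

end PaperPCl
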